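/- Define Ŝ = F̂ + B̂ − L̂ + Ĝ (applied to the same matrix argument). For all complex n×n matrices C and D the following commutation relations hold: [(F̂−L̂)(C), (F̂−L̂)(D)] = (F̂−L̂)([C,D]); [(B̂−L̂)(C), (B̂−L̂)(D)] = −(B̂−L̂)([C,D]); [(F̂−L̂)(C), (B̂−L̂)(D)] = 0; [(F̂−L̂)(C), Ŝ(D)] = Ŝ(CD) − tr(CD)·id; [(B̂−L̂)(C), Ŝ(D)] = Ŝ(DC) − tr(DC)·id; and [Ŝ(C), Ŝ(D)] = 0. -/

import Mathlib

open scoped Matrix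

open ContinuousLinearMap in
/-- `Lhat c A ρ = Σ_{j,k} A j k • (c k * ρ * (c j)†)`. -/
noncomputable def Lhat {F : Type*} [NormedAddCommGroup F] [InnerProductSpace ℂ F]
    [FiniteDimensional ℂ F] {n : ℕ} (c : Fin n → F →L[ℂ] F)
    (A : Matrix (Fin n) (Fin n) ℂ) : (F →L[ℂ] F) →L[ℂ] (F →L[ℂ] F) :=
  ∑ j, ∑ k, A j k • mulLeftRight ℂ (F →L[ℂ] F) (c k) (adjoint (c j))

open ContinuousLinearMap in
/-- `Ghat c A ρ = Σ_{j,k} A j k • ((c j)† * ρ * c k)`. -/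
noncomputable def Ghat {F : Type*} [NormedAddCommGroup F] [InnerProductSpace ℂ F]
    [FiniteDimensional ℂ F] {n : ℕ} (c : Fin n → F →L[ℂ] F)
    (A : Matrix (Fin n) (Fin n) ℂ) : (F →L[ℂ] F) →L[ℂ] (F →L[ℂ] F) :=
  ∑ j, ∑ k, A j k • mulLeftRight ℂ (F →L[ℂ] F) (adjoint (c j)) (c k)

open ContinuousLinearMap in
/-- The quadratic form `(c, A c) = Σ_{j,k} A j k • ((c j)† * c k)`. -/
noncomputable def quadOp {F : Type*} [NormedAddCommGroup F] [InnerProductSpace ℂ F]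
    [FiniteDimensional ℂ F] {n : ℕ} (c : Fin n → F →L[ℂ] F)
    (A : Matrix (Fin n) (Fin n) ℂ) : F →L[ℂ] F :=
  ∑ j, ∑ k, A j k • (adjoint (c j) * c k)

open ContinuousLinearMap in
/-- `Fhat c A ρ = (c, A c) * ρ`. -/
noncomputable def Fhat {F : Type*} [NormedAddCommGroup F] [InnerProductSpace ℂ F]
    [FiniteDimensional ℂ F] {n : ℕ} (c : Fin n → F →L[ℂ] F)
    (A : Matrix (Fin n) (Fin n) ℂ) : (F →L[ℂ] F) →L[ℂ] (F →L[ℂ] F) :=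
  mul ℂ (F →L[ℂ] F) (quadOp c A)

open ContinuousLinearMap in
/-- `Bhat c A ρ = ρ * (c, A c)`. -/
noncomputable def Bhat {F : Type*} [NormedAddCommGroup F] [InnerProductSpace ℂ F]
    [FiniteDimensional ℂ F] {n : ℕ} (c : Fin n → F →L[ℂ] F)
    (A : Matrix (Fin n) (Fin n) ℂ) : (F →L[ℂ] F) →L[ℂ] (F →L[ℂ] F) :=
  mulLeftRight ℂ (F →L[ℂ] F) 1 (quadOp c A)

/-- The Liouvillian
`L(A, M) = L̂(−A − A† − M) + Ĝ(M) + F̂(A + M) + B̂(A† + M) − (tr M)·id`. -/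
noncomputable def Liou {F : Type*} [NormedAddCommGroup F] [InnerProductSpace ℂ F]
    [FiniteDimensional ℂ F] {n : ℕ} (c : Fin n → F →L[ℂ] F)
    (A M : Matrix (Fin n) (Fin n) ℂ) : (F →L[ℂ] F) →L[ℂ] (F →L[ℂ] F) :=
  Lhat c (-A - Aᴴ - M) + Ghat c M + Fhat c (A + M) + Bhat c (Aᴴ + M)
    - M.trace • (1 : (F →L[ℂ] F) →L[ℂ] (F →L[ℂ] F))

/-- `Ŝ = F̂ + B̂ − L̂ + Ĝ` (applied to the same matrix argument). -/
noncomputable def Shat {F : Type*} [NormedAddCommGroup F] [InnerProductSpace ℂ F]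
    [FiniteDimensional ℂ F] {n : ℕ} (c : Fin n → F →L[ℂ] F)
    (A : Matrix (Fin n) (Fin n) ℂ) : (F →L[ℂ] F) →L[ℂ] (F →L[ℂ] F) :=
  Fhat c A + Bhat c A - Lhat c A + Ghat c A

namespace Aux4

noncomputable def H {R : Type*} [Ring R] [Algebra ℂ R] {n : ℕ} (T : Fin n → Fin n → R)
    (A : Matrix (Fin n) (Fin n) ℂ) : R := ∑ j, ∑ k, A j k • T j k

theorem comm {R : Type*} [Ring R] [Algebra ℂ R] {n : ℕ} (T U V W : Fin n → Fin n → R) (e : R)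
    (h : ∀ j k l m, T j k * U l m - U l m * T j k = (if k = l then V j m else 0)
      + (if j = m then W l k else 0) + (if k = l then if j = m then e else 0 else 0))
    (C D : Matrix (Fin n) (Fin n) ℂ) :
    H T C * H U D - H U D * H T C = H V (C * D) + H W (D * C) + (C * D).trace • e := by
  have g : ∀ (T U : Fin n → Fin n → R) (C D : Matrix (Fin n) (Fin n) ℂ),
      H T C * H U D = ∑ p : Fin n × Fin n, ∑ q : Fin n × Fin n,
        (C p.1 p.2 * D q.1 q.2) • (T p.1 p.2 * U q.1 q.2) := by
    intro T U C D
    simp only [H, ← Fintype.sum_prod_type' (f := fun j k => D j k • U j k),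
      ← Fintype.sum_prod_type' (f := fun j k => C j k • T j k)]
    rw [Finset.sum_mul_sum]
    simp only [smul_mul_smul_comm]
  have h1 : H T C * H U D = ∑ j, ∑ k, ∑ l, ∑ m, (C j k * D l m) • (T j k * U l m) := by
    rw [g]
    simp only [Fintype.sum_prod_type]
  have h2 : H U D * H T C = ∑ j, ∑ k, ∑ l, ∑ m, (C j k * D l m) • (U l m * T j k) := by
    rw [g, Finset.sum_comm]
    simp only [Fintype.sum_prod_type, mul_comm (D _ _)]
  rw [h1, h2]
  simp only [← Finset.sum_sub_distrib, ← smul_sub, h, smul_add, Finset.sum_add_distrib]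
  congr 1
  · congr 1
    · simp only [H, Matrix.mul_apply, Finset.sum_smul, smul_ite, smul_zero]
      refine Finset.sum_congr rfl fun j _ => ?_
      rw [Finset.sum_comm' (t' := Finset.univ) (s' := fun _ => Finset.univ) (by simp)]
      rw [Finset.sum_comm]
      conv_rhs => rw [Finset.sum_comm]
      refine Finset.sum_congr rfl fun k _ => ?_
      rw [Finset.sum_comm]
      simp
    · simp only [H, Matrix.mul_apply, Finset.sum_smul, smul_ite, smul_zero]
      simp only [Finset.sum_ite_eq, Finset.mem_univ, if_true, mul_comm (C _ _)]
      conv_lhs => enter [2, j]; rw [Finset.sum_comm]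
      rw [Finset.sum_comm]
      refine Finset.sum_congr rfl fun j _ => ?_
      rw [Finset.sum_comm]
  · simp only [Matrix.trace, Matrix.diag, Matrix.mul_apply, Finset.sum_smul, smul_ite, smul_zero]
    refine Finset.sum_congr rfl fun j _ => Finset.sum_congr rfl fun k _ => ?_
    rw [Finset.sum_comm]
    simp

section
variable {R : Type*} [Ring R] {n : ℕ} (c d : Fin n → R)

theorem ff (hcc : ∀ j k, c j * c k + c k * c j = 0)
    (hcd : ∀ j k, c j * d k + d k * c j = if j = k then 1 else 0)
    (hdd : ∀ j k, d j * d k + d k * d j = 0) (j k l m : Fin n) :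
    d j * c k * (d l * c m) - d l * c m * (d j * c k) =
      (if k = l then d j * c m else 0) - (if j = m then d l * c k else 0) := by
  have e1 : (if k = l then d j * c m else 0) = d j * (c k * d l + d l * c k) * c m := by
    rw [hcd]; split_ifs <;> simp
  have e2 : (if j = m then d l * c k else 0) = d l * (c m * d j + d j * c m) * c k := by
    rw [hcd]; simp only [eq_comm (a := j)]; split_ifs <;> simp
  rw [e1, e2]
  have a1 : d j * d l * (c k * c m + c m * c k) = 0 := by rw [hcc, mul_zero]
  have a2 : (d j * d l + d l * d j) * (c m * c k) = 0 := by rw [hdd, zero_mul]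
  linear_combination (norm := noncomm_ring) a2 - a1

theorem fc (hcc : ∀ j k, c j * c k + c k * c j = 0)
    (hcd : ∀ j k, c j * d k + d k * c j = if j = k then 1 else 0) (j k m : Fin n) :
    d j * c k * c m - c m * (d j * c k) = - (if j = m then c k else 0) := by
  have e2 : (if j = m then c k else 0) = (c m * d j + d j * c m) * c k := by
    rw [hcd]; simp only [eq_comm (a := j)]; split_ifs <;> simp
  rw [e2]
  have a1 : d j * (c k * c m + c m * c k) = 0 := by rw [hcc, mul_zero]
  linear_combination (norm := noncomm_ring) a1

theorem fd (hcd : ∀ j k, c j * d k + d k * c j = if j = k then 1 else 0)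
    (hdd : ∀ j k, d j * d k + d k * d j = 0) (j k l : Fin n) :
    d j * c k * d l - d l * (d j * c k) = (if k = l then d j else 0) := by
  have e2 : (if k = l then d j else 0) = d j * (c k * d l + d l * c k) := by
    rw [hcd]; split_ifs <;> simp
  rw [e2]
  have a1 : (d j * d l + d l * d j) * c k = 0 := by rw [hdd, zero_mul]
  linear_combination (norm := noncomm_ring) -a1
end

theorem fin {R : Type*} [Ring R] (f f' b b' l l' g g' fx fy bx by' lx ly gx gy t : R)
    (cFF : f * f' - f' * f = fx + -fy)
    (cBB : b * b' - b' * b = -bx + by')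
    (cFB : f * b' - b' * f = 0) (cFB' : f' * b - b * f' = 0)
    (cFL : f * l' - l' * f = -ly) (cFL' : f' * l - l * f' = -lx)
    (cFG : f * g' - g' * f = gx) (cFG' : f' * g - g * f' = gy)
    (cBL : b * l' - l' * b = -lx) (cBL' : b' * l - l * b' = -ly)
    (cBG : b * g' - g' * b = gy) (cBG' : b' * g - g * b' = gx)
    (cLL : l * l' - l' * l = 0) (cGG : g * g' - g' * g = 0)
    (cLG : l * g' - g' * l = -bx + -fy + t) (cLG' : l' * g - g * l' = -by' + -fx + t) :
    (f - l) * (f' - l') - (f' - l') * (f - l) = fx - fy - (lx - ly) ∧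
    (b - l) * (b' - l') - (b' - l') * (b - l) = -(bx - by' - (lx - ly)) ∧
    (f - l) * (b' - l') - (b' - l') * (f - l) = 0 ∧
    (f - l) * (f' + b' - l' + g') - (f' + b' - l' + g') * (f - l) = fx + bx - lx + gx - t ∧
    (b - l) * (f' + b' - l' + g') - (f' + b' - l' + g') * (b - l) = fy + by' - ly + gy - t ∧
    (f + b - l + g) * (f' + b' - l' + g') - (f' + b' - l' + g') * (f + b - l + g) = 0 := by
  refine ⟨?_, ?_, ?_, ?_, ?_, ?_⟩
  · linear_combination (norm := noncomm_ring) cFF - cFL + cFL' + cLL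
  · linear_combination (norm := noncomm_ring) cBB - cBL + cBL' + cLL
  · linear_combination (norm := noncomm_ring) cFB - cFL + cBL' + cLL
  · linear_combination (norm := noncomm_ring) cFF + cFB - cFL + cFG + cFL' + cBL' + cLL - cLG
  · linear_combination (norm := noncomm_ring) cBB - cFB' - cBL + cBG + cFL' + cBL' + cLL - cLG
  · linear_combination (norm := noncomm_ring) cFF + cFB - cFL + cFG + cBB - cFB' - cBL + cBG
      + cFL' + cBL' + cLL - cLG - cFG' - cBG' + cLG' + cGG

end Aux4

set_option maxHeartbeats 4000000 in
open Aux4 in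
/-- the commutation relations for `F̂−L̂`, `B̂−L̂` and `Ŝ`. -/
theorem stmt4 {n : ℕ} (hn : 0 < n)
    {F : Type*} [NormedAddCommGroup F] [InnerProductSpace ℂ F] [FiniteDimensional ℂ F]
    (c : Fin n → F →L[ℂ] F)
    (hcc : ∀ j k, c j * c k + c k * c j = 0)
    (hcd : ∀ j k, c j * ContinuousLinearMap.adjoint (c k)
      + ContinuousLinearMap.adjoint (c k) * c j = if j = k then 1 else 0)
    (hdd : ∀ j k, ContinuousLinearMap.adjoint (c j) * ContinuousLinearMap.adjoint (c k)
      + ContinuousLinearMap.adjoint (c k) * ContinuousLinearMap.adjoint (c j) = 0)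
    (C D : Matrix (Fin n) (Fin n) ℂ) :
    (Fhat c C - Lhat c C) * (Fhat c D - Lhat c D)
        - (Fhat c D - Lhat c D) * (Fhat c C - Lhat c C)
      = Fhat c (C * D - D * C) - Lhat c (C * D - D * C) ∧
    (Bhat c C - Lhat c C) * (Bhat c D - Lhat c D)
        - (Bhat c D - Lhat c D) * (Bhat c C - Lhat c C)
      = -(Bhat c (C * D - D * C) - Lhat c (C * D - D * C)) ∧
    (Fhat c C - Lhat c C) * (Bhat c D - Lhat c D)
        - (Bhat c D - Lhat c D) * (Fhat c C - Lhat c C) = 0 ∧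
    (Fhat c C - Lhat c C) * Shat c D - Shat c D * (Fhat c C - Lhat c C)
      = Shat c (C * D) - (C * D).trace • (1 : (F →L[ℂ] F) →L[ℂ] (F →L[ℂ] F)) ∧
    (Bhat c C - Lhat c C) * Shat c D - Shat c D * (Bhat c C - Lhat c C)
      = Shat c (D * C) - (D * C).trace • (1 : (F →L[ℂ] F) →L[ℂ] (F →L[ℂ] F)) ∧
    Shat c C * Shat c D - Shat c D * Shat c C = 0 := by
  set d : Fin n → F →L[ℂ] F := fun j => ContinuousLinearMap.adjoint (c j) with hd
  have hcd' : ∀ j k, c j * d k + d k * c j = if j = k then 1 else 0 := hcd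
  have hdd' : ∀ j k, d j * d k + d k * d j = 0 := hdd
  let M := ContinuousLinearMap.mulLeftRight ℂ (F →L[ℂ] F)
  let TF : Fin n → Fin n → ((F →L[ℂ] F) →L[ℂ] (F →L[ℂ] F)) := fun j k => M (d j * c k) 1
  let TB : Fin n → Fin n → ((F →L[ℂ] F) →L[ℂ] (F →L[ℂ] F)) := fun j k => M 1 (d j * c k)
  let TL : Fin n → Fin n → ((F →L[ℂ] F) →L[ℂ] (F →L[ℂ] F)) := fun j k => M (c k) (d j)
  let TG : Fin n → Fin n → ((F →L[ℂ] F) →L[ℂ] (F →L[ℂ] F)) := fun j k => M (d j) (c k)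
  have hM : ∀ a b x, M a b x = a * x * b := fun a b x => rfl
  have hF : ∀ A, Fhat c A = H TF A := by
    intro A
    refine ContinuousLinearMap.ext fun x => ?_
    simp [Fhat, quadOp, H, TF, hM, hd]
  have hB : ∀ A, Bhat c A = H TB A := by
    intro A
    refine ContinuousLinearMap.ext fun x => ?_
    simp [Bhat, quadOp, H, TB, hM, hd]
  have hL : ∀ A, Lhat c A = H TL A := fun A => rfl
  have hG : ∀ A, Ghat c A = H TG A := fun A => rfl
  have Hn : ∀ (T : Fin n → Fin n → ((F →L[ℂ] F) →L[ℂ] (F →L[ℂ] F))) A,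
      H (fun j k => - T j k) A = - H T A := by intro T A; simp [H]
  have H0 : ∀ A, H (fun _ _ => (0 : (F →L[ℂ] F) →L[ℂ] (F →L[ℂ] F)))
      (A : Matrix (Fin n) (Fin n) ℂ) = 0 := by intro A; simp [H]
  have Hs : ∀ (T : Fin n → Fin n → ((F →L[ℂ] F) →L[ℂ] (F →L[ℂ] F))) A B,
      H T (A - B) = H T A - H T B := by
    intro T A B; simp [H, sub_smul, Finset.sum_sub_distrib]
  have hmul : ∀ a b a' b', M a b * M a' b' = M (a * a') (b' * b) := by
    intro a b a' b'
    refine ContinuousLinearMap.ext fun x => ?_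
    simp only [mul_apply_eq_comp, hM, mul_assoc]
  have Ms1 : ∀ a a' b, M a b - M a' b = M (a - a') b := by intro a a' b; simp
  have Ms2 : ∀ a b b', M a b - M a b' = M a (b - b') := by intro a b b'; simp
  have M11 : M 1 1 = 1 := by ext x; simp [hM]
  have cFF := fun C D => comm TF TF TF (fun j k => - TF j k) 0 (by
    intro j k l m
    simp only [TF, hmul, Ms1, mul_one, ff c d hcc hcd' hdd' j k l m]
    split_ifs <;> simp [sub_eq_add_neg]) C D
  have cBB := fun C D => comm TB TB (fun j k => - TB j k) TB 0 (by
    intro j k l m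
    rw [← neg_sub]
    simp only [TB, hmul, Ms2, mul_one, ff c d hcc hcd' hdd' j k l m]
    split_ifs <;> simp [sub_eq_add_neg, add_comm]) C D
  have cFB := fun C D => comm TF TB (fun _ _ => 0) (fun _ _ => 0) 0 (by
    intro j k l m
    simp [TF, TB, hmul]) C D
  have cFL := fun C D => comm TF TL (fun _ _ => 0) (fun j k => - TL j k) 0 (by
    intro j k l m
    simp only [TF, TL, hmul, Ms1, mul_one, one_mul, fc c d hcc hcd' j k m]
    split_ifs <;> simp) C D
  have cFG := fun C D => comm TF TG TG (fun _ _ => 0) 0 (by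
    intro j k l m
    simp only [TF, TG, hmul, Ms1, mul_one, one_mul, fd c d hcd' hdd' j k l]
    split_ifs <;> simp) C D
  have cBL := fun C D => comm TB TL (fun j k => - TL j k) (fun _ _ => 0) 0 (by
    intro j k l m
    rw [← neg_sub]
    simp only [TB, TL, hmul, Ms2, mul_one, one_mul, fd c d hcd' hdd' j k l]
    split_ifs <;> simp) C D
  have cBG := fun C D => comm TB TG (fun _ _ => 0) TG 0 (by
    intro j k l m
    rw [← neg_sub]
    simp only [TB, TG, hmul, Ms2, mul_one, one_mul, fc c d hcc hcd' j k m]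
    split_ifs <;> simp) C D
  have cLL := fun C D => comm TL TL (fun _ _ => 0) (fun _ _ => 0) 0 (by
    intro j k l m
    simp only [TL, hmul]
    rw [eq_neg_of_add_eq_zero_left (hcc k m), eq_neg_of_add_eq_zero_left (hdd' l j)]
    simp) C D
  have cGG := fun C D => comm TG TG (fun _ _ => 0) (fun _ _ => 0) 0 (by
    intro j k l m
    simp only [TG, hmul]
    rw [eq_neg_of_add_eq_zero_left (hcc m k), eq_neg_of_add_eq_zero_left (hdd' j l)]
    simp) C D
  have cLG := fun C D => comm TL TG (fun j k => - TB j k) (fun j k => - TF j k) 1 (by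
    intro j k l m
    simp only [TL, TG, TB, TF, hmul]
    rw [eq_sub_of_add_eq (hcd' k l), eq_sub_of_add_eq (hcd' m j), ← M11]
    simp only [eq_comm (a := m)]
    split_ifs <;> simp <;> abel) C D
  simp only [Hn, H0, smul_zero, add_zero, zero_add] at cFF cBB cFB cFL cFG cBL cBG cLL cGG cLG
  simp only [Shat, hF, hB, hL, hG, Hs]
  have h := cLG D C
  have ht := Matrix.trace_mul_comm C D
  rw [← ht] at h ⊢
  exact fin _ _ _ _ _ _ _ _ _ _ _ _ _ _ _ _ _ (cFF C D) (cBB C D) (cFB C D) (cFB D C) (cFL C D)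
    (cFL D C) (cFG C D) (cFG D C) (cBL C D) (cBL D C) (cBG C D) (cBG D C) (cLL C D) (cGG C D)
    (cLG C D) h
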